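/- Let B be a finite-dimensional K-algebra with a fixed complete set e_1,…,e_n of pairwise orthogonal primitive idempotents, P(i) = Be_i and S(i) = P(i)/rad P(i). If Ext^1_B(S(i),S(j)) = 0 for all i > j, then rad_B(P(j),P(i)) = 0 for all j < i; equivalently e_j(rad B)e_i = 0 for all j < i, i.e. every homomorphism P(j) → P(i) with j < i whose image lies in (rad B)P(i) is zero. -/

import Mathlib

/-!
STATEMENT 12.

`B` is a finite-dimensional algebra over an algebraically closed field `K`, with a complete
set `e 0, …, e (n-1)` of pairwise orthogonal primitive idempotents; `P(i) = Be_i` is encoded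
as `leftIdeal B (e i)` and `S(i)` as its top `P(i)/(rad B)P(i)`.  The Jacobson radical is the
intersection of the maximal left ideals.  The hypothesis `Ext¹_B(S(i),S(j)) = 0` for `i > j`
is rendered as: every short exact sequence `0 → S(j) → E → S(i) → 0` splits.
-/

noncomputable section

def mulRightLin (A : Type*) [Ring A] (a : A) : A →ₗ[A] A where
  toFun x := x * a
  map_add' x y := add_mul x y a
  map_smul' r x := by simp [smul_eq_mul, mul_assoc]

/-- the left ideal `Aa`, i.e. the projective module `P(i)` when `a = e_i` -/
def leftIdeal (A : Type*) [Ring A] (a : A) : Submodule A A := LinearMap.range (mulRightLin A a)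

/-- the Jacobson radical: the intersection of all maximal left ideals -/
def jacRad (A : Type*) [Ring A] : Ideal A := sInf {I : Ideal A | I.IsMaximal}

/-- the submodule `(rad A)·M` of a module `M` -/
def radM (A : Type*) [Ring A] (M : Type*) [AddCommGroup M] [Module A M] : Submodule A M :=
  Submodule.span A {x | ∃ r ∈ jacRad A, ∃ m : M, x = r • m}

/-- `rad_A(M,N)`: homomorphisms whose image is contained in `(rad A)·N` -/
def IsRadHom (A : Type*) [Ring A] {M N : Type*} [AddCommGroup M] [Module A M]
    [AddCommGroup N] [Module A N] (f : M →ₗ[A] N) : Prop :=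
  LinearMap.range f ≤ radM A N

def IsPrimitiveIdem (A : Type*) [Ring A] (x : A) : Prop :=
  IsIdempotentElem x ∧ x ≠ 0 ∧ ∀ y z : A, IsIdempotentElem y → IsIdempotentElem z →
    y * z = 0 → z * y = 0 → x = y + z → y = 0 ∨ z = 0

/-- the simple top `S(i) = P(i)/rad P(i)` -/
abbrev simpleTop (A : Type*) [Ring A] (a : A) :=
  ↥(leftIdeal A a) ⧸ radM A ↥(leftIdeal A a)

theorem jacRad_eq_jacobson (A : Type*) [Ring A] : jacRad A = Ring.jacobson A :=
  (Ring.jacobson_eq_sInf_isMaximal A).symm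

theorem smul_mem_radM {A M : Type*} [Ring A] [AddCommGroup M] [Module A M] {r : A}
    (hr : r ∈ jacRad A) (m : M) : r • m ∈ radM A M :=
  Submodule.subset_span ⟨r, hr, m, rfl⟩

theorem jacRad_smul_quotient_radM {A M : Type*} [Ring A] [AddCommGroup M] [Module A M] {r : A}
    (hr : r ∈ jacRad A) (x : M ⧸ radM A M) : r • x = 0 := by
  obtain ⟨m, rfl⟩ := Submodule.mkQ_surjective _ x
  rw [← map_smul, Submodule.mkQ_apply, Submodule.Quotient.mk_eq_zero]
  exact smul_mem_radM hr m

theorem isSemisimpleModule_of_jacRad_smul {A M : Type*} [Ring A] [IsArtinianRing A]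
    [AddCommGroup M] [Module A M] (h : ∀ r ∈ jacRad A, ∀ m : M, r • m = 0) :
    IsSemisimpleModule A M := by
  have hM : Module.IsTorsionBySet A M (Ring.jacobson A) := fun m r =>
    h r (by rw [jacRad_eq_jacobson]; exact r.2) m
  let _ : Module (A ⧸ Ring.jacobson A) M := hM.module
  exact hM.isSemisimpleModule_iff.mp inferInstance

/-- Elements of the image of `S → X` are detected by homomorphisms `X → S` when `S` and `X` are
semisimple. -/
theorem eq_zero_of_forall_hom_apply_eq_zero {A S X : Type*} [Ring A] [AddCommGroup S]
    [Module A S] [AddCommGroup X] [Module A X] [IsSemisimpleModule A S] [IsSemisimpleModule A X]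
    (f : S →ₗ[A] X) (s : S) (h : ∀ g : X →ₗ[A] S, g (f s) = 0) : f s = 0 := by
  obtain ⟨t, ht⟩ := IsSemisimpleModule.lifting_property f.rangeRestrict
    f.surjective_rangeRestrict LinearMap.id
  obtain ⟨g, hg⟩ := IsSemisimpleModule.extension_property (LinearMap.range f).subtype
    (Submodule.subtype_injective _) t
  have h₁ : t ⟨f s, s, rfl⟩ = 0 := by
    rw [← h g, ← hg]
    rfl
  have h₂ := LinearMap.congr_fun ht ⟨f s, s, rfl⟩
  rw [LinearMap.comp_apply, h₁, map_zero] at h₂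
  exact (congrArg Subtype.val h₂).symm

/-- If every extension of `P/rad P` by `M` splits and `rad A` kills `M`, then every homomorphism
`rad P → M` vanishes on the generators of `rad P`: consider the pushout of
`0 → rad P → P → P/rad P → 0`. -/
theorem apply_smul_eq_zero_of_forall_split {A P M : Type u} [Ring A] [AddCommGroup P]
    [Module A P] [AddCommGroup M] [Module A M] (hM : ∀ r ∈ jacRad A, ∀ m : M, r • m = 0)
    (hsplit : ∀ (E : Type u) (_ : AddCommGroup E) (_ : Module A E)
      (ι : M →ₗ[A] E) (p : E →ₗ[A] P ⧸ radM A P),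
      Function.Injective ι → Function.Surjective p → Function.Exact ι p →
      ∃ s : P ⧸ radM A P →ₗ[A] E, p ∘ₗ s = LinearMap.id)
    (g : radM A P →ₗ[A] M) {r : A} (hr : r ∈ jacRad A) (y : P) :
    g ⟨r • y, smul_mem_radM hr y⟩ = 0 := by
  let N : Submodule A (M × P) := LinearMap.range (g.prod (-(radM A P).subtype))
  let ι : M →ₗ[A] (M × P) ⧸ N := N.mkQ ∘ₗ LinearMap.inl A M P
  let q : M × P →ₗ[A] P ⧸ radM A P := (radM A P).mkQ ∘ₗ LinearMap.snd A M P
  have hq : N ≤ LinearMap.ker q := by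
    rintro _ ⟨x, rfl⟩
    simp [q]
  let p : (M × P) ⧸ N →ₗ[A] P ⧸ radM A P := N.liftQ q hq
  have hι : Function.Injective ι := by
    rw [← LinearMap.ker_eq_bot, LinearMap.ker_eq_bot']
    intro m hm
    obtain ⟨x, hx⟩ := (Submodule.Quotient.mk_eq_zero N).mp hm
    have h₁ : g x = m := congrArg Prod.fst hx
    have h₂ : -(x : P) = 0 := congrArg Prod.snd hx
    have h₃ : x = 0 := Subtype.ext (neg_eq_zero.mp h₂)
    rw [← h₁, h₃, map_zero]
  have hp : Function.Surjective p := by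
    intro z
    obtain ⟨w, rfl⟩ := Submodule.mkQ_surjective _ z
    exact ⟨N.mkQ (0, w), rfl⟩
  have hexact : Function.Exact ι p := by
    intro z
    obtain ⟨⟨m, w⟩, rfl⟩ := Submodule.mkQ_surjective _ z
    constructor
    · intro hz
      have hw : w ∈ radM A P := (Submodule.Quotient.mk_eq_zero _).mp hz
      refine ⟨m + g ⟨w, hw⟩, (Submodule.Quotient.eq N).mpr ⟨⟨w, hw⟩, ?_⟩⟩
      simp
    · rintro ⟨m', hm'⟩
      rw [← hm']
      exact (Submodule.Quotient.mk_eq_zero _).mpr (Submodule.zero_mem _)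
  obtain ⟨s, hs⟩ := hsplit _ _ _ ι p hι hp hexact
  have hkill : ∀ z : (M × P) ⧸ N, r • z = 0 := by
    intro z
    have hz : p (z - s (p z)) = 0 := by
      rw [map_sub, sub_eq_zero]
      exact (LinearMap.congr_fun hs (p z)).symm
    obtain ⟨m, hm⟩ := (hexact _).mp hz
    rw [← sub_add_cancel z (s (p z)), ← hm, smul_add, ← map_smul, ← map_smul, hM r hr,
      jacRad_smul_quotient_radM hr, map_zero, map_zero, add_zero]
  apply hι
  rw [map_zero, ← hkill (N.mkQ (0, y)), ← map_smul]
  exact (Submodule.Quotient.eq N).mpr ⟨⟨r • y, smul_mem_radM hr y⟩, by simp⟩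

theorem coe_mem_jacRad_of_mem_radM {A : Type*} [Ring A] {I : Submodule A A} {x : I}
    (hx : x ∈ radM A I) : (x : A) ∈ jacRad A := by
  have h : radM A I ≤ Submodule.comap I.subtype (jacRad A) := by
    refine Submodule.span_le.mpr ?_
    rintro _ ⟨r, hr, m, rfl⟩
    change r * (m : A) ∈ jacRad A
    rw [jacRad_eq_jacobson] at hr ⊢
    exact Ideal.mul_mem_right _ _ hr
  exact h hx

theorem mem_leftIdeal_self {A : Type*} [Ring A] {a : A} (ha : IsIdempotentElem a) :
    a ∈ leftIdeal A a :=
  ⟨a, ha⟩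

theorem mul_eq_self_of_mem_leftIdeal {A : Type*} [Ring A] {a x : A} (ha : IsIdempotentElem a)
    (hx : x ∈ leftIdeal A a) : x * a = x := by
  obtain ⟨y, rfl⟩ := hx
  change y * a * a = y * a
  rw [mul_assoc, ha.eq]

/-- The vanishing of `Ext¹(S_a, S_b)` forces `b (rad A) a ⊆ (rad A)²`. -/
theorem mul_mem_jacRad_sq_of_forall_split {A : Type u} [Ring A] [IsArtinianRing A] {a b : A}
    (ha : IsIdempotentElem a) (hb : IsIdempotentElem b)
    (hsplit : ∀ (E : Type u) (_ : AddCommGroup E) (_ : Module A E)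
      (ι : simpleTop A b →ₗ[A] E) (p : E →ₗ[A] simpleTop A a),
      Function.Injective ι → Function.Surjective p → Function.Exact ι p →
      ∃ s : simpleTop A a →ₗ[A] E, p ∘ₗ s = LinearMap.id)
    {r : A} (hr : r ∈ jacRad A) : b * r * a ∈ jacRad A * jacRad A := by
  let T : Submodule A (jacRad A) := jacRad A • ⊤
  have hmul : r * a ∈ jacRad A := by
    rw [jacRad_eq_jacobson] at hr ⊢
    exact Ideal.mul_mem_right _ _ hr
  have hbra : b * r * a ∈ jacRad A := by
    rw [mul_assoc]
    exact Ideal.mul_mem_left _ _ hmul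
  have hX : ∀ s ∈ jacRad A, ∀ x : jacRad A ⧸ T, s • x = 0 := by
    intro s hs x
    obtain ⟨x, rfl⟩ := Submodule.mkQ_surjective _ x
    rw [← map_smul]
    exact (Submodule.Quotient.mk_eq_zero _).mpr (Submodule.smul_mem_smul hs trivial)
  have : IsSemisimpleModule A (jacRad A ⧸ T) := isSemisimpleModule_of_jacRad_smul hX
  have : IsSemisimpleModule A (simpleTop A b) :=
    isSemisimpleModule_of_jacRad_smul fun s hs x => jacRad_smul_quotient_radM hs x
  let f₀ : leftIdeal A b →ₗ[A] jacRad A ⧸ T :=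
    T.mkQ ∘ₗ LinearMap.toSpanSingleton A (jacRad A) ⟨r * a, hmul⟩ ∘ₗ (leftIdeal A b).subtype
  have hf₀ : radM A (leftIdeal A b) ≤ LinearMap.ker f₀ := by
    refine Submodule.span_le.mpr ?_
    rintro _ ⟨s, hs, m, rfl⟩
    change f₀ (s • m) = 0
    rw [map_smul, hX s hs]
  let f : simpleTop A b →ₗ[A] jacRad A ⧸ T := (radM A (leftIdeal A b)).liftQ f₀ hf₀
  let incl : radM A (leftIdeal A a) →ₗ[A] jacRad A :=
    ((leftIdeal A a).subtype ∘ₗ (radM A (leftIdeal A a)).subtype).codRestrict (jacRad A)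
      fun x => coe_mem_jacRad_of_mem_radM x.2
  have hfb : f ((radM A (leftIdeal A b)).mkQ ⟨b, mem_leftIdeal_self hb⟩) =
      T.mkQ ⟨b * r * a, hbra⟩ :=
    congrArg T.mkQ (Subtype.ext (mul_assoc b r a).symm)
  have hbr : b * r ∈ jacRad A := Ideal.mul_mem_left _ _ hr
  have hzero := eq_zero_of_forall_hom_apply_eq_zero f
    ((radM A (leftIdeal A b)).mkQ ⟨b, mem_leftIdeal_self hb⟩) fun g => by
      rw [hfb]
      exact apply_smul_eq_zero_of_forall_split
        (fun s hs x => jacRad_smul_quotient_radM hs x) hsplit (g ∘ₗ T.mkQ ∘ₗ incl) hbr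
        ⟨a, mem_leftIdeal_self ha⟩
  rw [hfb] at hzero
  have hT : (⟨b * r * a, hbra⟩ : jacRad A) ∈ T := (Submodule.Quotient.mk_eq_zero _).mp hzero
  have hmap : T.map (jacRad A).subtype ≤ jacRad A * jacRad A := by
    rw [Submodule.map_smul'', Submodule.map_subtype_top]
    exact le_of_eq rfl
  exact hmap ⟨_, hT, rfl⟩

/-- An order-triangularity principle: if `eⱼ J eᵢ ⊆ J²` for all `j < i`, with `J` the radical,
then `eⱼ J eᵢ = 0` for all `j < i`. -/
theorem mul_mul_eq_zero_of_mem_jacRad_sq {A ι : Type*} [Ring A] [IsArtinianRing A] [Fintype ι]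
    [LinearOrder ι] (e : ι → A) (hcomplete : ∑ i, e i = 1)
    (hsq : ∀ i j, j < i → ∀ r ∈ jacRad A, e j * r * e i ∈ jacRad A * jacRad A)
    (hidem : ∀ i, IsIdempotentElem (e i)) {i j : ι} (hij : j < i) {r : A} (hr : r ∈ jacRad A) :
    e j * r * e i = 0 := by
  have htwo : (jacRad A).IsTwoSided := by rw [jacRad_eq_jacobson]; infer_instance
  have hpow : ∀ m : ℕ, ∀ i j, j < i → ∀ r ∈ jacRad A, e j * r * e i ∈ jacRad A ^ (m + 1) := by
    intro m
    induction m with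
    | zero =>
      intro i j _ r hr
      rw [zero_add, Submodule.pow_one]
      exact Ideal.mul_mem_right _ _ (Ideal.mul_mem_left _ _ hr)
    | succ m ih =>
      have key : ∀ i j, j < i → ∀ x ∈ jacRad A * jacRad A,
          e j * x * e i ∈ jacRad A ^ (m + 1 + 1) := by
        intro i j hij x hx
        induction hx using Submodule.mul_induction_on' with
        | mem_mul_mem x hx y hy =>
          have hsum : e j * (x * y) * e i = ∑ k, (e j * x * e k) * (e k * y * e i) := by
            calc e j * (x * y) * e i = e j * x * (∑ k, e k * e k) * (y * e i) := by
                  simp only [(hidem _).eq, hcomplete, mul_one, mul_assoc]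
              _ = ∑ k, (e j * x * e k) * (e k * y * e i) := by
                  simp only [Finset.mul_sum, Finset.sum_mul, mul_assoc]
          rw [hsum]
          refine Submodule.sum_mem _ fun k _ => ?_
          have h₁ : ∀ i j, ∀ z ∈ jacRad A, e j * z * e i ∈ jacRad A := fun i j z hz =>
            Ideal.mul_mem_right _ _ (Ideal.mul_mem_left _ _ hz)
          rcases lt_or_ge k i with hk | hk
          · rw [Ideal.IsTwoSided.pow_succ]
            exact Ideal.mul_mem_mul (h₁ _ _ _ hx) (ih i k hk y hy)
          · rw [Submodule.pow_succ]
            exact Ideal.mul_mem_mul (ih k j (hij.trans_le hk) x hx) (h₁ _ _ _ hy)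
        | add x _ y _ hx hy =>
          rw [mul_add, add_mul]
          exact add_mem hx hy
      intro i j hij r hr
      have h := key i j hij _ (hsq i j hij r hr)
      rwa [show e j * (e j * r * e i) * e i = e j * r * e i by
        simp only [← mul_assoc, (hidem j).eq]
        rw [mul_assoc, (hidem i).eq]] at h
  obtain ⟨m, hm⟩ := IsSemiprimaryRing.isNilpotent (R := A)
  have h := Ideal.pow_le_pow_right (Nat.le_succ m) (hpow m i j hij r hr)
  rw [jacRad_eq_jacobson, hm] at h
  exact h

theorem stmt12
    {K : Type u} [Field K] [IsAlgClosed K]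
    {B : Type u} [Ring B] [Algebra K B] [FiniteDimensional K B]
    (n : ℕ) (e : Fin n → B)
    (hidem : ∀ i, IsPrimitiveIdem B (e i))
    (horth : ∀ i j, i ≠ j → e i * e j = 0)
    (hcomplete : ∑ i, e i = 1)
    -- hypothesis: `Ext¹_B(S(i), S(j)) = 0` for all `i > j`, i.e. every short exact
    -- sequence `0 → S(j) → E → S(i) → 0` of `B`-modules splits
    (hext : ∀ i j : Fin n, j < i →
      ∀ (E : Type u) (_ : AddCommGroup E) (_ : Module B E)
        (ι : simpleTop B (e j) →ₗ[B] E) (p : E →ₗ[B] simpleTop B (e i)),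
        Function.Injective ι → Function.Surjective p → Function.Exact ι p →
        ∃ s : simpleTop B (e i) →ₗ[B] E, p ∘ₗ s = LinearMap.id) :
    -- conclusion: `rad_B(P(j), P(i)) = 0` for all `j < i`; equivalently
    -- `e_j (rad B) e_i = 0` for all `j < i`
    (∀ i j : Fin n, j < i →
      ∀ f : ↥(leftIdeal B (e j)) →ₗ[B] ↥(leftIdeal B (e i)), IsRadHom B f → f = 0) ∧
    (∀ i j : Fin n, j < i → ∀ r ∈ jacRad B, e j * r * e i = 0) := by
  have hrad : ∀ i j : Fin n, j < i → ∀ r ∈ jacRad B, e j * r * e i = 0 := by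
    have : IsArtinianRing B := IsArtinianRing.of_finite K B
    intro i j hij r hr
    exact mul_mul_eq_zero_of_mem_jacRad_sq e hcomplete
      (fun i j hij r hr =>
        mul_mem_jacRad_sq_of_forall_split (hidem i).1 (hidem j).1 (hext i j hij) hr)
      (fun i => (hidem i).1) hij hr
  refine ⟨fun i j hij f hf => ?_, hrad⟩
  let u : leftIdeal B (e j) := ⟨e j, mem_leftIdeal_self (hidem j).1⟩
  have hx : ∀ x : leftIdeal B (e j), x = (x : B) • u := fun x =>
    Subtype.ext (mul_eq_self_of_mem_leftIdeal (hidem j).1 x.2).symm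
  have hu : f u = 0 := by
    have h₁ : e j * (f u : B) = f u := by
      have h := congrArg (fun y => (f y : B)) (hx u)
      simp only [map_smul] at h
      exact h.symm
    have h₂ := hrad i j hij _ (coe_mem_jacRad_of_mem_radM (hf ⟨u, rfl⟩))
    rw [h₁, mul_eq_self_of_mem_leftIdeal (hidem i).1 (f u).2] at h₂
    exact Subtype.ext h₂
  ext1 x
  rw [hx x, map_smul, hu, smul_zero, LinearMap.zero_apply]

end
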